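/- arXiv:1704.07534 — 3 statements merged into one kernel-verified Lean document; each statement's English description precedes it below -/
import Mathlib

section
/- Let T be a densely defined closed linear operator from a dense subspace D(T) of a complex Hilbert space H1 into a complex Hilbert space H2. If T attains its reduced minimum, then the range R(T) = {Tx : x ∈ D(T)} is a closed subspace of H2. -/
variable {H1 H2 : Type*} [NormedAddCommGroup H1] [InnerProductSpace ℂ H1] [CompleteSpace H1]
  [NormedAddCommGroup H2] [InnerProductSpace ℂ H2] [CompleteSpace H2]

/-- The null space `N(T) = {x ∈ D(T) : T x = 0}` of a partially defined operator,
as a submodule of `H1`. -/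
def pNull (T : H1 →ₗ.[ℂ] H2) : Submodule ℂ H1 :=
  (LinearMap.ker T.toFun).map T.domain.subtype

/-- The reduced minimum modulus `γ(T) = inf {‖T x‖ : x ∈ C(T) = D(T) ∩ N(T)ᗮ, ‖x‖ = 1}`. -/
noncomputable def pGamma (T : H1 →ₗ.[ℂ] H2) : ℝ :=
  sInf {r : ℝ | ∃ x : T.domain, (x : H1) ∈ (pNull T)ᗮ ∧ ‖(x : H1)‖ = 1 ∧ ‖T x‖ = r}

/-- `T` attains its reduced minimum. -/
def PAttainsRM (T : H1 →ₗ.[ℂ] H2) : Prop :=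
  ∃ x : T.domain, (x : H1) ∈ (pNull T)ᗮ ∧ ‖(x : H1)‖ = 1 ∧ ‖T x‖ = pGamma T

section

variable {E F : Type*} [NormedAddCommGroup E] [InnerProductSpace ℂ E]
  [NormedAddCommGroup F] [InnerProductSpace ℂ F]

theorem mem_pNull_iff_mem_graph (T : E →ₗ.[ℂ] F) (x : E) :
    x ∈ pNull T ↔ (x, (0 : F)) ∈ T.graph := by
  simp [pNull, LinearPMap.mem_graph_iff, LinearMap.mem_ker, and_comm]

theorem isClosed_pNull (T : E →ₗ.[ℂ] F)
    (hclosed : IsClosed (T.graph : Set (E × F))) : IsClosed (pNull T : Set E) := by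
  have h : (pNull T : Set E) = (fun x => (x, (0 : F))) ⁻¹' (T.graph : Set (E × F)) := by
    ext x
    exact mem_pNull_iff_mem_graph T x
  rw [h]
  exact hclosed.preimage (by fun_prop)

/-- Attaining the reduced minimum forces `γ(T) > 0`. -/
theorem PAttainsRM.pGamma_pos {T : E →ₗ.[ℂ] F} (hRM : PAttainsRM T) : 0 < pGamma T := by
  obtain ⟨x, hx, hx1, hxT⟩ := hRM
  rw [← hxT, norm_pos_iff]
  intro h0
  have hN : (x : E) ∈ pNull T := ⟨x, h0, rfl⟩
  have hzero : (x : E) = 0 :=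
    (Submodule.disjoint_def.mp (pNull T).orthogonal_disjoint) _ hN hx
  simp [hzero] at hx1

theorem pGamma_mul_norm_le (T : E →ₗ.[ℂ] F) (x : T.domain) (hx : (x : E) ∈ (pNull T)ᗮ) :
    pGamma T * ‖(x : E)‖ ≤ ‖T x‖ := by
  rcases eq_or_ne (x : E) 0 with h0 | h0
  · simp [h0]
  have hpos : 0 < ‖(x : E)‖ := norm_pos_iff.mpr h0
  have hle : pGamma T ≤ ‖(x : E)‖⁻¹ * ‖T x‖ := by
    refine csInf_le ⟨0, ?_⟩ ⟨((‖(x : E)‖⁻¹ : ℝ) : ℂ) • x, ?_, ?_, ?_⟩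
    · rintro _ ⟨z, -, -, rfl⟩
      exact norm_nonneg _
    · exact Submodule.smul_mem _ _ hx
    · simp [norm_smul, h0]
    · simp [LinearPMap.map_smul, norm_smul]
  rwa [inv_mul_eq_div, le_div_iff₀ hpos] at hle

/-- The part of the graph of `T` lying over `N(T)ᗮ`. -/
noncomputable def carrierGraph (T : E →ₗ.[ℂ] F) : Submodule ℂ (E × F) :=
  T.graph ⊓ (pNull T)ᗮ.comap (LinearMap.fst ℂ E F)

theorem isClosed_carrierGraph (T : E →ₗ.[ℂ] F)
    (hclosed : IsClosed (T.graph : Set (E × F))) :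
    IsClosed (carrierGraph T : Set (E × F)) :=
  hclosed.inter ((pNull T).isClosed_orthogonal.preimage continuous_fst)

theorem norm_le_of_mem_carrierGraph {T : E →ₗ.[ℂ] F} (hpos : 0 < pGamma T) {p : E × F}
    (hp : p ∈ carrierGraph T) : ‖p‖ ≤ max 1 (pGamma T)⁻¹ * ‖p.2‖ := by
  obtain ⟨hg, ho⟩ := hp
  obtain ⟨x, hx, hT⟩ := (LinearPMap.mem_graph_iff T).mp hg
  have hxo : (x : E) ∈ (pNull T)ᗮ := hx ▸ ho
  have hle := pGamma_mul_norm_le T x hxo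
  rw [hx, hT, ← le_inv_mul_iff₀ hpos] at hle
  refine max_le (hle.trans ?_) (le_mul_of_one_le_left (norm_nonneg _) (le_max_left _ _))
  gcongr
  exact le_max_right _ _

/-- Every value of `T` is attained on `C(T) = D(T) ∩ N(T)ᗮ`. -/
theorem range_eq_range_snd_carrierGraph [CompleteSpace E] (T : E →ₗ.[ℂ] F)
    (hclosed : IsClosed (T.graph : Set (E × F))) :
    {y : F | ∃ x : T.domain, T x = y} =
      Set.range ((ContinuousLinearMap.snd ℂ E F).comp (carrierGraph T).subtypeL) := by
  have : CompleteSpace (pNull T) := (isClosed_pNull T hclosed).completeSpace_coe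
  ext y
  constructor
  · rintro ⟨x, rfl⟩
    set P := (pNull T).starProjection (x : E)
    have hP : (P, (0 : F)) ∈ T.graph :=
      (mem_pNull_iff_mem_graph T P).mp ((pNull T).starProjection_apply_mem (x : E))
    have hmem : ((x : E) - P, T x) ∈ T.graph := by
      simpa using T.graph.sub_mem (T.mem_graph x) hP
    exact ⟨⟨_, hmem, (pNull T).sub_starProjection_mem_orthogonal (x : E)⟩, rfl⟩
  · rintro ⟨⟨p, hp⟩, rfl⟩
    obtain ⟨x, -, hx⟩ := (LinearPMap.mem_graph_iff T).mp hp.1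
    exact ⟨x, hx⟩

end

theorem attainsRM_isClosed_range (T : H1 →ₗ.[ℂ] H2)
    (hdense : Dense (T.domain : Set H1))
    (hclosed : IsClosed (T.graph : Set (H1 × H2)))
    (hRM : PAttainsRM T) :
    IsClosed {y : H2 | ∃ x : T.domain, T x = y} := by
  have : CompleteSpace (carrierGraph T) := (isClosed_carrierGraph T hclosed).completeSpace_coe
  rw [range_eq_range_snd_carrierGraph T hclosed]
  set S := (ContinuousLinearMap.snd ℂ H1 H2).comp (carrierGraph T).subtypeL
  have hS : AntilipschitzWith (max 1 (pGamma T)⁻¹).toNNReal S := by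
    refine AddMonoidHomClass.antilipschitz_of_bound S fun p => ?_
    rw [Real.coe_toNNReal _ (zero_le_one.trans (le_max_left _ _))]
    exact norm_le_of_mem_carrierGraph hRM.pGamma_pos p.2
  exact hS.isClosed_range S.uniformContinuous
end

section
/- Let H be a nontrivial complex Hilbert space and T : H → H a bounded self-adjoint operator. Then m(T) = d(0, σ(T)), i.e., inf{‖Tx‖ : ‖x‖ = 1} = inf{|λ| : λ ∈ σ(T)}. -/
variable {H : Type*} [NormedAddCommGroup H] [InnerProductSpace ℂ H] [CompleteSpace H]

/-- The minimum modulus of a bounded operator. -/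
noncomputable def mB (T : H →L[ℂ] H) : ℝ :=
  sInf {r : ℝ | ∃ x : H, ‖x‖ = 1 ∧ ‖T x‖ = r}

omit [CompleteSpace H] in
theorem mB_mul_norm_le (T : H →L[ℂ] H) (x : H) : mB T * ‖x‖ ≤ ‖T x‖ := by
  rcases eq_or_ne x 0 with rfl | hx
  · simp
  have hpos : 0 < ‖x‖ := norm_pos_iff.2 hx
  have hle : mB T ≤ ‖T ((‖x‖⁻¹ : ℂ) • x)‖ := by
    refine csInf_le ⟨0, ?_⟩ ⟨_, ?_, rfl⟩
    · rintro _ ⟨y, -, rfl⟩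
      exact norm_nonneg _
    · simp [norm_smul, hpos.ne']
  rwa [map_smul, norm_smul, norm_inv, Complex.norm_real, norm_norm, inv_mul_eq_div,
    le_div_iff₀ hpos] at hle

/-- An operator which is bounded below together with its adjoint is invertible. -/
theorem ContinuousLinearMap.isUnit_of_bounded_below (f : H →L[ℂ] H) {c : ℝ} (hc : 0 < c)
    (hf : ∀ x, c * ‖x‖ ≤ ‖f x‖) (hf' : ∀ x, c * ‖x‖ ≤ ‖f.adjoint x‖) : IsUnit f := by
  rw [isUnit_iff_bijective, bijective_iff_dense_range_and_antilipschitz]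
  refine ⟨?_, ⟨c⁻¹, by positivity⟩, f.antilipschitz_of_bound fun x ↦ ?_⟩
  · rw [Submodule.topologicalClosure_eq_top_iff, orthogonal_range, Submodule.eq_bot_iff]
    intro x hx
    have hle := hf' x
    rw [show f.adjoint x = 0 from hx, norm_zero] at hle
    exact norm_le_zero_iff.1 (nonpos_of_mul_nonpos_right hle hc)
  · change ‖x‖ ≤ c⁻¹ * ‖f x‖
    rw [inv_mul_eq_div, le_div_iff₀ hc, mul_comm]
    exact hf x

theorem IsSelfAdjoint.mB_le_norm_of_mem_spectrum {T : H →L[ℂ] H} (hT : IsSelfAdjoint T) {z : ℂ}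
    (hz : z ∈ spectrum ℂ T) : mB T ≤ ‖z‖ := by
  by_contra! hlt
  have bound (w : ℂ) (hw : ‖w‖ = ‖z‖) (x : H) :
      (mB T - ‖z‖) * ‖x‖ ≤ ‖(algebraMap ℂ (H →L[ℂ] H) w - T) x‖ := by
    have h := norm_sub_norm_le (T x) (w • x)
    rw [norm_smul, hw, norm_sub_rev] at h
    have := mB_mul_norm_le T x
    simp only [sub_apply, ContinuousLinearMap.algebraMap_apply]
    linarith
  refine hz (ContinuousLinearMap.isUnit_of_bounded_below _ (sub_pos.2 hlt) (bound z rfl) ?_)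
  rw [← ContinuousLinearMap.star_eq_adjoint, star_sub, hT.star_eq, ← algebraMap_star_comm]
  exact bound _ (norm_star z)

theorem IsSelfAdjoint.exists_mem_spectrum_norm_eq [Nontrivial H] {T : H →L[ℂ] H}
    (hT : IsSelfAdjoint T) : ∃ z ∈ spectrum ℂ T, ‖z‖ = ‖T‖ := by
  obtain ⟨z, hz, h⟩ := spectrum.exists_nnnorm_eq_spectralRadius T
  rw [hT.spectralRadius_eq_nnnorm, ENNReal.coe_inj] at h
  exact ⟨z, hz, congrArg NNReal.toReal h⟩

theorem IsSelfAdjoint.exists_mem_spectrum_norm_le [Nontrivial H] {T : H →L[ℂ] H}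
    (hT : IsSelfAdjoint T) {x : H} (hx : ‖x‖ = 1) : ∃ z ∈ spectrum ℂ T, ‖z‖ ≤ ‖T x‖ := by
  by_cases h0 : (0 : ℂ) ∈ spectrum ℂ T
  · exact ⟨0, h0, by simp⟩
  obtain ⟨u, rfl⟩ := (spectrum.zero_notMem_iff ℂ).1 h0
  have hu : star u = u := Units.ext hT.star_eq
  have hinv : IsSelfAdjoint (↑u⁻¹ : H →L[ℂ] H) := by
    rw [isSelfAdjoint_iff, ← Units.coe_star, star_inv, hu]
  obtain ⟨z, hz, hnorm⟩ := hinv.exists_mem_spectrum_norm_eq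
  refine ⟨z⁻¹, spectrum.inv₀_mem_iff.2 hz, ?_⟩
  have hle : 1 ≤ ‖z‖ * ‖(u : H →L[ℂ] H) x‖ := by
    have h := (↑u⁻¹ : H →L[ℂ] H).le_opNorm ((u : H →L[ℂ] H) x)
    rwa [← mul_apply_eq_comp, Units.inv_mul, one_apply_eq_self, hx,
      ← hnorm] at h
  have hz0 : 0 < ‖z‖ := pos_of_mul_pos_left (one_pos.trans_le hle) (norm_nonneg _)
  rw [norm_inv]
  exact (inv_le_iff_one_le_mul₀' hz0).2 hle

theorem min_modulus_eq_dist_spectrum [Nontrivial H] (T : H →L[ℂ] H)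
    (hT : IsSelfAdjoint T) :
    mB T = sInf {r : ℝ | ∃ z ∈ spectrum ℂ T, ‖z‖ = r} := by
  apply le_antisymm
  · obtain ⟨z, hz⟩ := spectrum.nonempty T
    refine le_csInf ⟨_, z, hz, rfl⟩ ?_
    rintro _ ⟨w, hw, rfl⟩
    exact hT.mB_le_norm_of_mem_spectrum hw
  · obtain ⟨x, hx⟩ := exists_norm_eq H zero_le_one
    refine le_csInf ⟨_, x, hx, rfl⟩ ?_
    rintro _ ⟨y, hy, rfl⟩
    obtain ⟨z, hz, hle⟩ := hT.exists_mem_spectrum_norm_le hy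
    refine le_trans (csInf_le ⟨0, ?_⟩ ⟨z, hz, rfl⟩) hle
    rintro _ ⟨w, -, rfl⟩
    exact norm_nonneg _
end

section
/- Let T be a densely defined closed linear operator from a dense subspace D(T) of a complex Hilbert space H1 into a complex Hilbert space H2. If T attains its reduced minimum, then T is minimum attaining. -/
variable {H1 H2 : Type*} [NormedAddCommGroup H1] [InnerProductSpace ℂ H1] [CompleteSpace H1]
  [NormedAddCommGroup H2] [InnerProductSpace ℂ H2] [CompleteSpace H2]

/-- The minimum modulus `m(T) = inf {‖T x‖ : x ∈ D(T), ‖x‖ = 1}`. -/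
noncomputable def pMin (T : H1 →ₗ.[ℂ] H2) : ℝ :=
  sInf {r : ℝ | ∃ x : T.domain, ‖(x : H1)‖ = 1 ∧ ‖T x‖ = r}

/-- `T` is minimum attaining. -/
def PAttainsMin (T : H1 →ₗ.[ℂ] H2) : Prop :=
  ∃ x : T.domain, ‖(x : H1)‖ = 1 ∧ ‖T x‖ = pMin T

section

variable {E F : Type*} [NormedAddCommGroup E] [InnerProductSpace ℂ E]
  [NormedAddCommGroup F] [InnerProductSpace ℂ F]

theorem pMin_eq_zero_of_map_eq_zero {T : E →ₗ.[ℂ] F} {x : T.domain}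
    (hx : ‖(x : E)‖ = 1) (hTx : T x = 0) : pMin T = 0 := by
  refine IsLeast.csInf_eq ⟨⟨x, hx, by simp [hTx]⟩, ?_⟩
  rintro r ⟨y, -, rfl⟩
  exact norm_nonneg _

theorem pAttainsMin_of_map_eq_zero {T : E →ₗ.[ℂ] F} {x : T.domain}
    (hx : (x : E) ≠ 0) (hTx : T x = 0) : PAttainsMin T := by
  have hy : ‖(((‖(x : E)‖⁻¹ : ℝ) : ℂ) • x : T.domain).1‖ = 1 := by
    simp [norm_smul, hx]
  have hTy : T (((‖(x : E)‖⁻¹ : ℝ) : ℂ) • x) = 0 := by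
    rw [T.map_smul, hTx, smul_zero]
  exact ⟨_, hy, by rw [hTy, norm_zero, pMin_eq_zero_of_map_eq_zero hy hTy]⟩

theorem pGamma_eq_pMin_of_pNull_eq_bot {T : E →ₗ.[ℂ] F} (h : pNull T = ⊥) :
    pGamma T = pMin T := by
  simp [pGamma, pMin, h]

end

theorem attainsRM_attainsMin (T : H1 →ₗ.[ℂ] H2)
    (hdense : Dense (T.domain : Set H1))
    (hclosed : IsClosed (T.graph : Set (H1 × H2)))
    (hRM : PAttainsRM T) :
    PAttainsMin T := by
  by_cases h : pNull T = ⊥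
  · obtain ⟨x, -, hx, hTx⟩ := hRM
    exact ⟨x, hx, hTx.trans (pGamma_eq_pMin_of_pNull_eq_bot h)⟩
  · obtain ⟨_, ⟨x, hTx, rfl⟩, hx⟩ := Submodule.exists_mem_ne_zero_of_ne_bot h
    exact pAttainsMin_of_map_eq_zero hx hTx
end
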